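/- arXiv:2002.04894 — 4 statements merged into one kernel-verified Lean document; each statement's English description precedes it below -/
import Mathlib

section
/- Let θ ∈ (0,1). Suppose two parent balls in ℝ³ with centers C₁, C₂ and radii ρ₁, ρ₂ > 0 satisfy the θ-criterion (max(ρ₁,ρ₂) + θ·min(ρ₁,ρ₂) ≤ θ·dist(C₁,C₂)). Let c₁, c₂ be points (child box centers) with dist(c₁, C₁) ≤ ρ₁/2 and dist(c₂, C₂) ≤ ρ₂/2, so that the child balls of radii ρ₁/2 and ρ₂/2 are contained in the respective parent balls. Then the children also satisfy the θ-criterion: max(ρ₁,ρ₂)/2 + θ·min(ρ₁,ρ₂)/2 ≤ θ·dist(c₁,c₂). Consequently, in the balanced-tree FMM, children of weakly connected parents are automatically well separated and need not be connected. -/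
/-- **Children of weakly connected parents satisfy the θ-criterion.**
If θ ∈ (0,1), two parent balls in ℝ³ with centers `C₁, C₂` and radii
`ρ₁, ρ₂ > 0` satisfy the θ-criterion, and child centers `c₁, c₂` satisfy
`dist c₁ C₁ ≤ ρ₁/2`, `dist c₂ C₂ ≤ ρ₂/2`, then the half-radius child balls
also satisfy the θ-criterion. -/
theorem children_inherit_theta_criterion
    (θ ρ₁ ρ₂ : ℝ) (hθ : θ ∈ Set.Ioo (0 : ℝ) 1) (hρ₁ : 0 < ρ₁) (hρ₂ : 0 < ρ₂)
    (C₁ C₂ c₁ c₂ : EuclideanSpace ℝ (Fin 3))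
    (hcrit : max ρ₁ ρ₂ + θ * min ρ₁ ρ₂ ≤ θ * dist C₁ C₂)
    (h₁ : dist c₁ C₁ ≤ ρ₁ / 2) (h₂ : dist c₂ C₂ ≤ ρ₂ / 2) :
    max ρ₁ ρ₂ / 2 + θ * (min ρ₁ ρ₂ / 2) ≤ θ * dist c₁ c₂ := by
  obtain ⟨hθ0, hθ1⟩ := hθ
  have htri : dist C₁ C₂ ≤ (max ρ₁ ρ₂ + min ρ₁ ρ₂) / 2 + dist c₁ c₂ := by
    have h := dist_triangle4 C₁ c₁ c₂ C₂
    rw [dist_comm C₁ c₁] at h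
    linarith [max_add_min ρ₁ ρ₂]
  have hmul := mul_le_mul_of_nonneg_left htri hθ0.le
  have hmax : θ * max ρ₁ ρ₂ ≤ max ρ₁ ρ₂ :=
    mul_le_of_le_one_left (le_max_of_le_left hρ₁.le) hθ1.le
  linarith
end

section
/- Let θ ∈ (0,1) and r > 0. Suppose two parent balls in ℝ³ of equal radius 2r with centers C₁, C₂ are strongly connected, i.e. the θ-criterion fails: 2r + θ·2r > θ·dist(C₁,C₂). Let c₁, c₂ be child centers with dist(c₁,C₁) ≤ r and dist(c₂,C₂) ≤ r, and suppose the child balls of equal radius r satisfy the θ-criterion, i.e. r·(1+θ) ≤ θ·dist(c₁,c₂). Then the child separation d_c = dist(c₁,c₂) lies in the spherical shell r·(1+θ)/θ ≤ d_c < 2r·(1+2θ)/θ. Thus each box's weakly connected interaction list lies in a shell whose inner radius is (1+θ)/θ times the box radius and whose outer radius is bounded by a fixed multiple thereof. -/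
/-- **Interaction-list shell.**
Let θ ∈ (0,1), r > 0. If parent balls of equal radius `2r` with centers
`C₁, C₂` are strongly connected (θ-criterion fails), child centers satisfy
`dist c₁ C₁ ≤ r`, `dist c₂ C₂ ≤ r`, and the child balls of radius `r` satisfy
the θ-criterion `r·(1+θ) ≤ θ·dist c₁ c₂`, then the child separation lies in
the shell `r·(1+θ)/θ ≤ dist c₁ c₂ < 2r·(1+2θ)/θ`. -/
theorem weak_connection_shell
    (θ r : ℝ) (hθ : θ ∈ Set.Ioo (0 : ℝ) 1) (hr : 0 < r)
    (C₁ C₂ c₁ c₂ : EuclideanSpace ℝ (Fin 3))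
    (hparent : θ * dist C₁ C₂ < 2 * r + θ * (2 * r))
    (h₁ : dist c₁ C₁ ≤ r) (h₂ : dist c₂ C₂ ≤ r)
    (hchild : r * (1 + θ) ≤ θ * dist c₁ c₂) :
    r * (1 + θ) / θ ≤ dist c₁ c₂ ∧ dist c₁ c₂ < 2 * r * (1 + 2 * θ) / θ := by
  have hθ₀ : 0 < θ := hθ.1
  have hdist : dist c₁ c₂ ≤ dist C₁ C₂ + 2 * r := by
    have := dist_triangle4 c₁ C₁ C₂ c₂
    rw [dist_comm C₂ c₂] at this
    linarith
  rw [div_le_iff₀ hθ₀, lt_div_iff₀ hθ₀]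
  refine ⟨by linarith, ?_⟩
  linarith [mul_le_mul_of_nonneg_left hdist hθ₀.le]
end

section
/- Let θ ∈ (0,1], let B ⊆ ℤ³ be a finite set of M box centers of a uniform grid of unit cubes (circumscribed radius √3/2), and suppose each box contains at most n source points. Then the total number of ordered point pairs (p,q) with p and q lying in two distinct strongly connected boxes — boxes at centers z, z' ∈ B for which (√3/2)·(1+θ) > θ·‖z − z'‖₂ — is at most (2√3 + 1)³·θ⁻³·M·n². In particular, with M boxes at the finest level each containing N/M of the N sources, the cost of the P2P direct evaluation is O(θ⁻³·N²/M). -/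
/-- Each coordinate offset between two strongly connected unit boxes is at most `√3 / θ`. -/
lemma abs_coord_le_of_strongly_connected {θ : ℝ} (hθ0 : 0 < θ) (hθ1 : θ ≤ 1) {d : Fin 3 → ℤ}
    (h : θ * Real.sqrt (∑ i, (d i : ℝ) ^ 2) < Real.sqrt 3 / 2 * (1 + θ)) (i : Fin 3) :
    |(d i : ℝ)| ≤ Real.sqrt 3 / θ := by
  have hcoord : |(d i : ℝ)| ≤ Real.sqrt (∑ j, (d j : ℝ) ^ 2) :=
    Real.abs_le_sqrt <|
      Finset.single_le_sum (f := fun j => (d j : ℝ) ^ 2) (fun j _ => sq_nonneg _)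
        (Finset.mem_univ i)
  rw [le_div_iff₀ hθ0]
  nlinarith [mul_le_mul_of_nonneg_left hcoord hθ0.le, Real.sqrt_nonneg 3]

/-- A set of pairs of points whose boxes lie in `B` and differ by an offset in `D` has at most
`n ^ 2 * (#B * #D)` elements when every box contains at most `n` points. -/
lemma card_pairs_le_of_offset_mem {P A : Type*} [AddCommGroup A] [DecidableEq A]
    (B D : Finset A) (pts : Finset P) (loc : P → A) (n : ℕ)
    (hn : ∀ z ∈ B, (pts.filter (loc · = z)).card ≤ n) (S : Finset (P × P))
    (hS : ∀ pq ∈ S, pq.1 ∈ pts ∧ pq.2 ∈ pts ∧ loc pq.1 ∈ B ∧ loc pq.2 ∈ B ∧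
      loc pq.1 - loc pq.2 ∈ D) :
    S.card ≤ n ^ 2 * (B.card * D.card) := by
  rw [← Finset.card_product]
  refine Finset.card_le_mul_card_image_of_maps_to
    (f := fun pq : P × P => (loc pq.1, loc pq.1 - loc pq.2)) (fun pq hpq => ?_) _ ?_
  · obtain ⟨-, -, h, -, h'⟩ := hS pq hpq
    exact Finset.mem_product.2 ⟨h, h'⟩
  rintro b -
  rcases (S.filter fun pq => (loc pq.1, loc pq.1 - loc pq.2) = b).eq_empty_or_nonempty with
    h | ⟨⟨p, q⟩, h⟩
  · simp [h]
  obtain ⟨hpq, rfl⟩ := Finset.mem_filter.1 h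
  obtain ⟨-, -, hp, hq, -⟩ := hS _ hpq
  calc _ ≤ (pts.filter (loc · = loc p) ×ˢ pts.filter (loc · = loc q)).card := by
        refine Finset.card_le_card fun x hx => ?_
        obtain ⟨hxS, hx⟩ := Finset.mem_filter.1 hx
        obtain ⟨h1, h2, -⟩ := hS x hxS
        obtain ⟨e1, e2⟩ := Prod.mk.inj hx
        rw [e1] at e2
        simp [h1, h2, e1, sub_right_injective e2]
    _ ≤ n ^ 2 := by
        rw [Finset.card_product, sq]
        exact Nat.mul_le_mul (hn _ hp) (hn _ hq)

/-- **P2P complexity bound.**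
Let θ ∈ (0,1], let `B` be a finite set of `M` box centers of a uniform grid of
unit cubes (circumscribed radius √3/2) in ℤ³, with at most `n` source points
per box. Then the number of ordered point pairs lying in two distinct strongly
connected boxes is at most `(2√3 + 1)³·θ⁻³·M·n²`. -/
theorem p2p_pair_count_bound
    {P : Type*} (θ : ℝ) (hθ0 : 0 < θ) (hθ1 : θ ≤ 1)
    (B : Finset (Fin 3 → ℤ)) (pts : Finset P) (loc : P → Fin 3 → ℤ) (n : ℕ)
    (hn : ∀ z ∈ B, Nat.card {p : P | p ∈ pts ∧ loc p = z} ≤ n) :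
    (Nat.card {pq : P × P | pq.1 ∈ pts ∧ pq.2 ∈ pts ∧
        loc pq.1 ∈ B ∧ loc pq.2 ∈ B ∧ loc pq.1 ≠ loc pq.2 ∧
        θ * Real.sqrt (∑ i, ((loc pq.1 i - loc pq.2 i : ℤ) : ℝ) ^ 2) <
          Real.sqrt 3 / 2 * (1 + θ)} : ℝ)
      ≤ (2 * Real.sqrt 3 + 1) ^ 3 * θ⁻¹ ^ 3 * B.card * n ^ 2 := by
  classical
  have hn' : ∀ z ∈ B, (pts.filter (loc · = z)).card ≤ n := fun z hz => by
    have h := hn z hz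
    rwa [← Finset.coe_filter, Nat.card_coe_set_eq, Set.ncard_coe_finset] at h
  set K : ℕ := ⌊Real.sqrt 3 / θ⌋₊
  set D : Finset (Fin 3 → ℤ) := Fintype.piFinset fun _ => Finset.Icc (-(K : ℤ)) K with hD
  have hDcard : D.card = (2 * K + 1) ^ 3 := by
    rw [hD, Fintype.card_piFinset_const, Int.card_Icc]
    congr 1
    omega
  set T := {pq : P × P | pq.1 ∈ pts ∧ pq.2 ∈ pts ∧
        loc pq.1 ∈ B ∧ loc pq.2 ∈ B ∧ loc pq.1 ≠ loc pq.2 ∧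
        θ * Real.sqrt (∑ i, ((loc pq.1 i - loc pq.2 i : ℤ) : ℝ) ^ 2) <
          Real.sqrt 3 / 2 * (1 + θ)}
  have hfin : T.Finite := (pts ×ˢ pts).finite_toSet.subset fun x hx => by
    simpa using ⟨hx.1, hx.2.1⟩
  have hcard : Nat.card T ≤ n ^ 2 * (B.card * D.card) := by
    rw [Nat.card_coe_set_eq, Set.ncard_eq_toFinset_card _ hfin]
    refine card_pairs_le_of_offset_mem B D pts loc n hn' _ fun pq hpq => ?_
    obtain ⟨h1, h2, h3, h4, -, h5⟩ := hfin.mem_toFinset.1 hpq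
    refine ⟨h1, h2, h3, h4, Fintype.mem_piFinset.2 fun i => ?_⟩
    have h := abs_coord_le_of_strongly_connected hθ0 hθ1
      (d := loc pq.1 - loc pq.2) h5 i
    rw [← Int.cast_abs, Int.abs_eq_natAbs, Int.cast_natCast] at h
    have := Nat.le_floor h
    rw [Finset.mem_Icc]
    omega
  have hside : 2 * (K : ℝ) + 1 ≤ (2 * Real.sqrt 3 + 1) * θ⁻¹ := by
    have h1 : (K : ℝ) ≤ Real.sqrt 3 * θ⁻¹ := Nat.floor_le (by positivity)
    have h2 : 1 ≤ θ⁻¹ := (one_le_inv₀ hθ0).2 hθ1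
    linarith
  calc (Nat.card T : ℝ) ≤ (n : ℝ) ^ 2 * (B.card * (2 * (K : ℝ) + 1) ^ 3) := by
        rw [hDcard] at hcard
        exact_mod_cast hcard
    _ ≤ (n : ℝ) ^ 2 * (B.card * ((2 * Real.sqrt 3 + 1) * θ⁻¹) ^ 3) := by gcongr
    _ = _ := by ring
end

section
/- Let S be a finite set of N points in ℝ³ such that for each of the three coordinate axes, the corresponding coordinate projection is injective on S, and let L be a natural number. Then there exists a family of 8^L pairwise disjoint axis-aligned boxes (products of three intervals) whose union contains S and such that each box contains at most ⌈N/8^L⌉ points of S. That is, recursive splitting of boxes at median planes produces a balanced octree: after L levels every leaf holds at most ⌈N/8^L⌉ sources. -/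
/-- A nonempty finite set on which `f` is injective has a median value of `f`. -/
theorem Finset.exists_median {α β : Type*} [LinearOrder β] (T : Finset α) (hT : T.Nonempty)
    (f : α → β) (hf : Set.InjOn f T) :
    ∃ c, (T.filter fun x => f x ≤ c).card ≤ (T.card + 1) / 2 ∧
      (T.filter fun x => c < f x).card ≤ (T.card + 1) / 2 := by
  classical
  have hpos : 0 < T.card := hT.card_pos
  have hcard : (T.image f).card = T.card := Finset.card_image_of_injOn hf
  let e := (T.image f).orderEmbOfFin hcard
  let k : Fin T.card := ⟨(T.card + 1) / 2 - 1, by omega⟩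
  have hle : (T.filter fun x => f x ≤ e k).card = (T.card + 1) / 2 := by
    have himage : (T.filter fun x => f x ≤ e k).image f = (Finset.Iic k).image e := by
      have hrange : T.image f = Finset.univ.image e :=
        (Finset.image_orderEmbOfFin_univ (T.image f) hcard).symm
      rw [← Finset.filter_image (p := fun y => y ≤ e k), hrange]
      ext y
      simp only [Finset.mem_filter, Finset.mem_image, Finset.mem_univ, true_and, Finset.mem_Iic]
      constructor
      · rintro ⟨⟨i, rfl⟩, hi⟩
        exact ⟨i, e.le_iff_le.1 hi, rfl⟩
      · rintro ⟨i, hi, rfl⟩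
        exact ⟨⟨i, rfl⟩, e.le_iff_le.2 hi⟩
    rw [← Finset.card_image_of_injOn (hf.mono (Finset.coe_subset.2 (Finset.filter_subset _ _))),
      himage, Finset.card_image_of_injective _ e.injective, Fin.card_Iic]
    simp only [k]
    omega
  have hadd := Finset.card_filter_add_card_filter_not (s := T) (fun x => f x ≤ e k)
  simp only [not_le] at hadd
  exact ⟨e k, by omega, by omega⟩

/-- Recursive bisection at medians, the `n`-th cut being orthogonal to the axis `axis n`,
distributes a finite set evenly among `2 ^ n` disjoint boxes. -/
theorem Finset.exists_balanced_bisection {α ι β : Type*} [LinearOrder β] [Nonempty β]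
    (S : Finset α) (f : ι → α → β) (hf : ∀ i, Set.InjOn (f i) S) (axis : ℕ → ι) (n : ℕ) :
    ∃ I : Fin (2 ^ n) → ι → Set β,
      (∀ j i, (I j i).OrdConnected) ∧
      (Pairwise fun j k => Disjoint {x | ∀ i, f i x ∈ I j i} {x | ∀ i, f i x ∈ I k i}) ∧
      (∀ x ∈ S, ∃ j, ∀ i, f i x ∈ I j i) ∧
      ∀ j, ((S : Set α) ∩ {x | ∀ i, f i x ∈ I j i}).ncard ≤ (S.card + 2 ^ n - 1) / 2 ^ n := by
  classical
  induction n with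
  | zero =>
    refine ⟨fun _ _ => Set.univ, fun _ _ => Set.ordConnected_univ, ?_, ?_, ?_⟩
    · intro j k hjk
      exact absurd (Subsingleton.elim (α := Fin 1) j k) hjk
    · exact fun x _ => ⟨0, fun i => Set.mem_univ _⟩
    · simp
  | succ n ih =>
    obtain ⟨I, hconn, hdisj, hcover, hcard⟩ := ih
    have hmedian (j : Fin (2 ^ n)) : ∃ c : β,
        ((S.filter fun x => ∀ i, f i x ∈ I j i).filter fun x => f (axis n) x ≤ c).card
          ≤ (S.card + 2 ^ (n + 1) - 1) / 2 ^ (n + 1) ∧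
        ((S.filter fun x => ∀ i, f i x ∈ I j i).filter fun x => c < f (axis n) x).card
          ≤ (S.card + 2 ^ (n + 1) - 1) / 2 ^ (n + 1) := by
      have hj := hcard j
      have hcoe : (S : Set α) ∩ {x | ∀ i, f i x ∈ I j i}
          = (S.filter fun x => ∀ i, f i x ∈ I j i : Finset α) := by
        ext x; simp
      rw [hcoe, Set.ncard_coe_finset] at hj
      have hhalf : ((S.card + 2 ^ n - 1) / 2 ^ n + 1) / 2
          = (S.card + 2 ^ (n + 1) - 1) / 2 ^ (n + 1) := by
        have hp : 0 < 2 ^ n := by positivity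
        rw [← Nat.add_div_right _ hp, Nat.div_div_eq_div_mul, pow_succ]
        congr 1
        omega
      rcases (S.filter fun x => ∀ i, f i x ∈ I j i).eq_empty_or_nonempty with hT | hT
      · rw [hT]
        exact ⟨Classical.arbitrary β, by simp⟩
      · obtain ⟨c, hc₁, hc₂⟩ := Finset.exists_median _ hT (f (axis n))
          ((hf (axis n)).mono (Finset.coe_subset.2 (Finset.filter_subset _ _)))
        exact ⟨c, by omega, by omega⟩
    choose c hlow hhigh using hmedian
    let half (j : Fin (2 ^ n)) (b : Bool) : Set β := if b then Set.Iic (c j) else Set.Ioi (c j)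
    let J (p : Fin (2 ^ n) × Bool) (i : ι) : Set β :=
      if i = axis n then I p.1 i ∩ half p.1 p.2 else I p.1 i
    have hJ (p : Fin (2 ^ n) × Bool) (x : α) : (∀ i, f i x ∈ J p i) ↔
        (∀ i, f i x ∈ I p.1 i) ∧ f (axis n) x ∈ half p.1 p.2 := by
      simp only [J]
      constructor
      · intro h
        refine ⟨fun i => ?_, ?_⟩
        · have hi := h i
          split_ifs at hi
          exacts [hi.1, hi]
        · have hi := h (axis n)
          rw [if_pos rfl] at hi
          exact hi.2
      · rintro ⟨h, hx⟩ i
        split_ifs with hi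
        · subst hi
          exact ⟨h _, hx⟩
        · exact h i
    have e : Fin (2 ^ (n + 1)) ≃ Fin (2 ^ n) × Bool :=
      Fintype.equivOfCardEq (by simp [pow_succ])
    refine ⟨fun j => J (e j), fun j i => ?_, ?_, fun x hx => ?_, fun j => ?_⟩
    · have hhalf : (half (e j).1 (e j).2).OrdConnected := by
        simp only [half]
        split_ifs
        exacts [Set.ordConnected_Iic, Set.ordConnected_Ioi]
      simp only [J]
      split_ifs
      exacts [(hconn _ _).inter hhalf, hconn _ _]
    · intro j k hjk
      rw [Set.disjoint_left]
      intro x hxj hxk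
      rw [Set.mem_ofPred_eq, hJ] at hxj hxk
      have hfst : (e j).1 = (e k).1 := by
        by_contra hne
        exact Set.disjoint_left.1 (hdisj hne) hxj.1 hxk.1
      refine hjk (e.injective (Prod.ext hfst ?_))
      have hj := hxj.2
      have hk := hxk.2
      rw [hfst] at hj
      cases hbj : (e j).2 <;> cases hbk : (e k).2 <;> simp [half, hbj, hbk] at hj hk ⊢
      · exact absurd hk hj.not_ge
      · exact absurd hj hk.not_ge
    · obtain ⟨j, hj⟩ := hcover x hx
      refine ⟨e.symm (j, decide (f (axis n) x ≤ c j)), ?_⟩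
      beta_reduce
      rw [Equiv.apply_symm_apply, hJ]
      refine ⟨hj, ?_⟩
      by_cases h : f (axis n) x ≤ c j
      · simp [half, h]
      · simp [half, h, not_le.1 h]
    · have hcoe : (S : Set α) ∩ {x | ∀ i, f i x ∈ J (e j) i}
          = ((S.filter fun x => ∀ i, f i x ∈ I (e j).1 i).filter
              fun x => f (axis n) x ∈ half (e j).1 (e j).2 : Finset α) := by
        ext x
        simp [hJ, and_assoc]
      rw [hcoe, Set.ncard_coe_finset]
      cases hb : (e j).2
      · simpa [half] using hhigh (e j).1
      · simpa [half] using hlow (e j).1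

/-- **Median splitting produces a balanced octree.**
Let `S` be a finite set of `N` points in ℝ³ whose three coordinate projections
are each injective on `S`, and let `L` be a natural number. Then there is a
family of `8^L` pairwise disjoint axis-aligned boxes (products of three
intervals) whose union contains `S` and such that each box contains at most
`⌈N/8^L⌉` points of `S`. -/
theorem median_split_balanced_octree
    (S : Finset (EuclideanSpace ℝ (Fin 3))) (N : ℕ) (hN : S.card = N) (L : ℕ)
    (hinj : ∀ i : Fin 3, Set.InjOn (fun x => x i) (S : Set (EuclideanSpace ℝ (Fin 3)))) :
    ∃ I : Fin (8 ^ L) → Fin 3 → Set ℝ,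
      (∀ j i, (I j i).OrdConnected) ∧
      (Pairwise fun j k =>
        Disjoint {x : EuclideanSpace ℝ (Fin 3) | ∀ i, x i ∈ I j i}
                 {x : EuclideanSpace ℝ (Fin 3) | ∀ i, x i ∈ I k i}) ∧
      ((S : Set (EuclideanSpace ℝ (Fin 3))) ⊆
        ⋃ j, {x : EuclideanSpace ℝ (Fin 3) | ∀ i, x i ∈ I j i}) ∧
      (∀ j, Nat.card ((S : Set (EuclideanSpace ℝ (Fin 3))) ∩
          {x : EuclideanSpace ℝ (Fin 3) | ∀ i, x i ∈ I j i} :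
            Set (EuclideanSpace ℝ (Fin 3)))
        ≤ (N + 8 ^ L - 1) / 8 ^ L) := by
  subst hN
  have hpow : 8 ^ L = 2 ^ (3 * L) := by rw [pow_mul]; norm_num
  rw [hpow]
  obtain ⟨I, hconn, hdisj, hcover, hcard⟩ :=
    S.exists_balanced_bisection (fun i x => x i) hinj (fun n => Fin.ofNat 3 n) (3 * L)
  exact ⟨I, hconn, hdisj, fun x hx => Set.mem_iUnion.2 (hcover x hx), hcard⟩
end
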